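/- arXiv:2605.31114 — 2 statements merged into one kernel-verified Lean document; each statement's English description precedes it below -/
import Mathlib

section
/- The Thue equation 3*x^3 - 2*y^3 = 1 has no integer solutions (x, y) with y = 2^t for some integer t ≥ 1. -/
/-- The order with basis `1, θ, φ`, `θ^2 = 2 φ`, `θ φ = 6`, `φ^2 = 3 θ`
(so `θ^3 = 12`, `φ^3 = 18`). -/
@[ext] structure CubS where
  p : ℤ
  q : ℤ
  r : ℤ

namespace CubS

instance : Zero CubS := ⟨⟨0, 0, 0⟩⟩
instance : One CubS := ⟨⟨1, 0, 0⟩⟩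
instance : Add CubS := ⟨fun a b => ⟨a.p + b.p, a.q + b.q, a.r + b.r⟩⟩
instance : Neg CubS := ⟨fun a => ⟨-a.p, -a.q, -a.r⟩⟩
instance : Mul CubS := ⟨fun a b =>
  ⟨a.p * b.p + 6 * (a.q * b.r + a.r * b.q),
   a.p * b.q + a.q * b.p + 3 * (a.r * b.r),
   a.p * b.r + a.r * b.p + 2 * (a.q * b.q)⟩⟩

@[simp] lemma zero_p : (0 : CubS).p = 0 := rfl
@[simp] lemma zero_q : (0 : CubS).q = 0 := rfl
@[simp] lemma zero_r : (0 : CubS).r = 0 := rfl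
@[simp] lemma one_p : (1 : CubS).p = 1 := rfl
@[simp] lemma one_q : (1 : CubS).q = 0 := rfl
@[simp] lemma one_r : (1 : CubS).r = 0 := rfl
@[simp] lemma add_p (a b : CubS) : (a + b).p = a.p + b.p := rfl
@[simp] lemma add_q (a b : CubS) : (a + b).q = a.q + b.q := rfl
@[simp] lemma add_r (a b : CubS) : (a + b).r = a.r + b.r := rfl
@[simp] lemma neg_p (a : CubS) : (-a).p = -a.p := rfl
@[simp] lemma neg_q (a : CubS) : (-a).q = -a.q := rfl
@[simp] lemma neg_r (a : CubS) : (-a).r = -a.r := rfl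
@[simp] lemma mul_p (a b : CubS) :
    (a * b).p = a.p * b.p + 6 * (a.q * b.r + a.r * b.q) := rfl
@[simp] lemma mul_q (a b : CubS) :
    (a * b).q = a.p * b.q + a.q * b.p + 3 * (a.r * b.r) := rfl
@[simp] lemma mul_r (a b : CubS) :
    (a * b).r = a.p * b.r + a.r * b.p + 2 * (a.q * b.q) := rfl

instance : CommRing CubS where
  add_assoc a b c := by ext <;> simp <;> ring
  zero_add a := by ext <;> simp
  add_zero a := by ext <;> simp
  add_comm a b := by ext <;> simp <;> ring
  neg_add_cancel a := by ext <;> simp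
  mul_assoc a b c := by ext <;> simp <;> ring
  one_mul a := by ext <;> simp
  mul_one a := by ext <;> simp
  mul_comm a b := by ext <;> simp <;> ring
  left_distrib a b c := by ext <;> simp <;> ring
  right_distrib a b c := by ext <;> simp <;> ring
  zero_mul a := by ext <;> simp
  mul_zero a := by ext <;> simp
  nsmul := nsmulRec
  zsmul := zsmulRec

/-- integer constants -/
def cst : ℤ →+* CubS where
  toFun n := ⟨n, 0, 0⟩
  map_one' := rfl
  map_zero' := rfl
  map_add' a b := by ext <;> simp
  map_mul' a b := by ext <;> simp

@[simp] lemma cst_p (n : ℤ) : (cst n).p = n := rfl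
@[simp] lemma cst_q (n : ℤ) : (cst n).q = 0 := rfl
@[simp] lemma cst_r (n : ℤ) : (cst n).r = 0 := rfl

/-- norm -/
def N : CubS →* ℤ where
  toFun a := a.p ^ 3 + 12 * a.q ^ 3 + 18 * a.r ^ 3 - 18 * a.p * a.q * a.r
  map_one' := by simp
  map_mul' a b := by simp; ring

lemma N_def (a : CubS) :
    N a = a.p ^ 3 + 12 * a.q ^ 3 + 18 * a.r ^ 3 - 18 * a.p * a.q * a.r := rfl

lemma exists_real : ∃ t f : ℝ, 1 ≤ t ∧ 1 ≤ f ∧ t ^ 2 = 2 * f ∧ t * f = 6 ∧ f ^ 2 = 3 * t := by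
  obtain ⟨t, ht0, ht⟩ : ∃ t : ℝ, 0 ≤ t ∧ t ^ 3 = 12 :=
    ⟨(12 : ℝ) ^ ((1 : ℝ) / 3), by positivity, by
      rw [← Real.rpow_natCast, ← Real.rpow_mul (by norm_num)]; norm_num⟩
  have h2 : 2 ≤ t := by
    by_contra h
    push Not at h
    nlinarith [mul_nonneg ht0 ht0, mul_nonneg ht0 (mul_nonneg ht0 ht0)]
  refine ⟨t, t ^ 2 / 2, by linarith, by nlinarith, by ring, by linarith, by
    linear_combination (t / 4) * ht⟩

/-- the real embedding -/
def ev (t f : ℝ) (h1 : t ^ 2 = 2 * f) (h2 : t * f = 6) (h3 : f ^ 2 = 3 * t) : CubS →+* ℝ where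
  toFun a := a.p + a.q * t + a.r * f
  map_one' := by simp
  map_zero' := by simp
  map_add' a b := by simp; ring
  map_mul' a b := by
    simp
    linear_combination (-(a.q * b.q : ℝ)) * h1 - (a.q * b.r + a.r * b.q : ℝ) * h2
      - (a.r * b.r : ℝ) * h3

section
variable (t f : ℝ) (h1 : t ^ 2 = 2 * f) (h2 : t * f = 6) (h3 : f ^ 2 = 3 * t)

lemma ev_def (a : CubS) : ev t f h1 h2 h3 a = a.p + a.q * t + a.r * f := rfl

lemma ev_N (a : CubS) : (N a : ℝ) = ev t f h1 h2 h3 a *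
    (((a.p - a.q * t : ℝ) ^ 2 + (a.q * t - a.r * f : ℝ) ^ 2 + (a.r * f - a.p : ℝ) ^ 2) / 2) := by
  have ht : t ^ 3 = 12 := by linear_combination t * h1 + 2 * h2
  have hf : f ^ 3 = 18 := by linear_combination f * h3 + 3 * h2
  rw [N_def, ev_def]
  push_cast
  linear_combination (-(a.q : ℝ) ^ 3) * ht - (a.r : ℝ) ^ 3 * hf + 3 * (a.p * a.q * a.r : ℝ) * h2

lemma ev_pos (a : CubS) (ha : N a = 1) : 0 < ev t f h1 h2 h3 a := by
  have h := ev_N t f h1 h2 h3 a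
  rw [ha] at h
  push_cast at h
  by_contra hn
  push Not at hn
  have : 0 ≤ ((a.p - a.q * t : ℝ) ^ 2 + (a.q * t - a.r * f : ℝ) ^ 2
    + (a.r * f - a.p : ℝ) ^ 2) / 2 := by positivity
  nlinarith [mul_nonneg (neg_nonneg.2 hn) this]

lemma fin_set (ht : 1 ≤ t) (hf : 1 ≤ f) (G : ℝ) :
    {a : CubS | N a = 1 ∧ 1 ≤ ev t f h1 h2 h3 a ∧ ev t f h1 h2 h3 a ≤ G}.Finite := by
  obtain ⟨B, hB⟩ := exists_nat_ge (G + 4)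
  have hfin : (Set.Icc (-(B : ℤ)) B ×ˢ (Set.Icc (-(B : ℤ)) B ×ˢ Set.Icc (-(B : ℤ)) B)).Finite :=
    (Set.finite_Icc _ _).prod ((Set.finite_Icc _ _).prod (Set.finite_Icc _ _))
  refine (hfin.image (fun z : ℤ × ℤ × ℤ => (⟨z.1, z.2.1, z.2.2⟩ : CubS))).subset ?_
  rintro a ⟨hN, hl, hu⟩
  have h := ev_N t f h1 h2 h3 a
  rw [hN] at h
  push_cast at h
  have hev := ev_def t f h1 h2 h3 a
  set R := ev t f h1 h2 h3 a
  set Y : ℝ := a.q * t with hY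
  set Z : ℝ := a.r * f with hZ
  have hq : ((a.p - Y : ℝ) ^ 2 + (Y - Z) ^ 2 + (Z - a.p) ^ 2) ≤ 2 := by
    have : 0 ≤ ((a.p - Y : ℝ) ^ 2 + (Y - Z) ^ 2 + (Z - a.p) ^ 2) := by positivity
    nlinarith
  have e1 := abs_le_of_sq_le_sq' (a := (a.p - Y : ℝ)) (b := 2) (by nlinarith [sq_nonneg (Y - Z), sq_nonneg (Z - a.p)]) (by norm_num)
  have e2 := abs_le_of_sq_le_sq' (a := Y - Z) (b := 2) (by nlinarith [sq_nonneg (a.p - Y), sq_nonneg (Z - a.p)]) (by norm_num)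
  have e3 := abs_le_of_sq_le_sq' (a := (Z - a.p : ℝ)) (b := 2) (by nlinarith [sq_nonneg (Y - Z), sq_nonneg (a.p - Y)]) (by norm_num)
  have key : ∀ (n : ℤ) (c : ℝ), 1 ≤ c → |n * c| ≤ B → n ∈ Set.Icc (-(B : ℤ)) B := by
    intro n c hc hn
    rw [abs_mul] at hn
    have h5 : |(n : ℝ)| ≤ B := by
      have : c ≤ |c| := le_abs_self c
      nlinarith [abs_nonneg (n : ℝ)]
    have h6 : |n| ≤ (B : ℤ) := by exact_mod_cast h5
    exact abs_le.1 h6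
  refine ⟨(a.p, a.q, a.r), ⟨key _ 1 le_rfl ?_, key _ t ht ?_, key _ f hf ?_⟩, rfl⟩
  · rw [abs_le]; constructor <;> linarith [e1.1, e1.2, e2.1, e2.2, e3.1, e3.2]
  · rw [abs_le]; constructor <;> linarith [e1.1, e1.2, e2.1, e2.2, e3.1, e3.2]
  · rw [abs_le]; constructor <;> linarith [e1.1, e1.2, e2.1, e2.2, e3.1, e3.2]
end

lemma N_zpow (u : CubSˣ) (hu : N (u : CubS) = 1) (n : ℤ) : N ((u ^ n : CubSˣ) : CubS) = 1 := by
  have h : Units.map N u = 1 := by ext; simpa using hu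
  have h2 : Units.map N (u ^ n) = 1 := by rw [map_zpow, h, one_zpow]
  exact congrArg Units.val h2

/-- Multiplicative dependence. -/
lemma depend (u g : CubSˣ) (hu : N (u : CubS) = 1) (hg : N (g : CubS) = 1)
    (hgp : 1 < (g : CubS).p) (hgq : 0 ≤ (g : CubS).q) (hgr : 0 ≤ (g : CubS).r) :
    ∃ (a : ℕ) (c : ℤ), 0 < a ∧ u ^ a = g ^ c := by
  obtain ⟨t, f, ht, hf, h1, h2, h3⟩ := exists_real
  let E := ev t f h1 h2 h3
  have hG : 1 < E g := by
    change (1 : ℝ) < (g : CubS).p + (g : CubS).q * t + (g : CubS).r * f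
    have a1 : (1 : ℝ) < (g : CubS).p := by exact_mod_cast hgp
    have a2 : (0 : ℝ) ≤ (g : CubS).q := by exact_mod_cast hgq
    have a3 : (0 : ℝ) ≤ (g : CubS).r := by exact_mod_cast hgr
    nlinarith [mul_nonneg a2 (by linarith : 0 ≤ t), mul_nonneg a3 (by linarith : 0 ≤ f)]
  have hU : 0 < E u := ev_pos t f h1 h2 h3 _ hu
  have hEz : ∀ (v : CubSˣ) (n : ℤ), E ((v ^ n : CubSˣ) : CubS) = (E v) ^ n := by
    intro v n
    have := congrArg Units.val (map_zpow (Units.map (E : CubS →* ℝ)) v n)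
    rw [Units.val_zpow_eq_zpow_val] at this
    exact this
  have hex : ∀ n : ℕ, ∃ m : ℤ, 1 ≤ E ((u ^ (n : ℤ) * g ^ (-m) : CubSˣ) : CubS) ∧
      E ((u ^ (n : ℤ) * g ^ (-m) : CubSˣ) : CubS) ≤ E g := by
    intro n
    obtain ⟨m, hm1, hm2⟩ := exists_mem_Ico_zpow (zpow_pos hU (n : ℤ)) hG
    have hp : 0 < E g ^ m := zpow_pos (by linarith) m
    refine ⟨m, ?_⟩
    rw [Units.val_mul, map_mul, hEz, hEz, zpow_neg, ← div_eq_mul_inv, le_div_iff₀ hp,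
      div_le_iff₀ hp]
    rw [zpow_add_one₀ (by linarith)] at hm2
    constructor
    · linarith
    · linarith [mul_comm (E g) (E g ^ m)]
  choose m hm using hex
  have hfin := fin_set t f h1 h2 h3 ht hf (E g)
  have := hfin.to_subtype
  obtain ⟨n1, n2, hne, heq⟩ := Finite.exists_ne_map_eq_of_infinite
    (fun n : ℕ => (⟨((u ^ (n : ℤ) * g ^ (-m n) : CubSˣ) : CubS), by
      refine ⟨?_, hm n⟩
      rw [Units.val_mul, map_mul, N_zpow u hu, N_zpow g hg, one_mul]⟩ :
      {a : CubS | N a = 1 ∧ 1 ≤ ev t f h1 h2 h3 a ∧ ev t f h1 h2 h3 a ≤ E g}))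
  have heq2 : u ^ (n1 : ℤ) * g ^ (-m n1) = u ^ (n2 : ℤ) * g ^ (-m n2) :=
    Units.ext (congrArg Subtype.val heq)
  have gen : ∀ i j : ℕ, i < j → u ^ (i : ℤ) * g ^ (-m i) = u ^ (j : ℤ) * g ^ (-m j) →
      ∃ (a : ℕ) (c : ℤ), 0 < a ∧ u ^ a = g ^ c := by
    intro i j hij h
    refine ⟨j - i, m j - m i, by omega, ?_⟩
    have e : (u ^ (j - i) : CubSˣ) = u ^ ((j : ℤ) - i) := by
      rw [← zpow_natCast]; congr 1; omega
    rw [e, zpow_sub, zpow_sub, ← div_eq_mul_inv, ← div_eq_mul_inv, div_eq_div_iff_mul_eq_mul]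
    rw [zpow_neg, zpow_neg, ← div_eq_mul_inv, ← div_eq_mul_inv, div_eq_div_iff_mul_eq_mul] at h
    rw [← h, mul_comm]
  rcases lt_or_gt_of_ne hne with h | h
  · exact gen _ _ h heq2
  · exact gen _ _ h heq2.symm

lemma pow_one_add (e : ℕ) (he : 1 ≤ e) (w : CubS) (m : ℕ) :
    ∃ z, (1 + 3 ^ e * w) ^ m = 1 + 3 ^ e * (m * w + 3 * z) := by
  obtain ⟨d, rfl⟩ : ∃ d, e = d + 1 := ⟨e - 1, by omega⟩
  induction m with
  | zero => exact ⟨0, by simp⟩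
  | succ m ih =>
    obtain ⟨z, hz⟩ := ih
    refine ⟨z + 3 ^ d * w * (m * w + 3 * z), ?_⟩
    rw [pow_succ, hz]
    push_cast
    ring

lemma pow_one_add' (k : ℕ) : ∀ (e : ℕ) (_ : 1 ≤ e) (w : CubS) (m : ℕ),
    ∃ z, (1 + 3 ^ e * w) ^ (3 ^ k * m) = 1 + 3 ^ (e + k) * (m * w + 3 * z) := by
  induction k with
  | zero => intro e he w m; simpa using pow_one_add e he w m
  | succ k ih =>
    intro e he w m
    obtain ⟨d, rfl⟩ : ∃ d, e = d + 1 := ⟨e - 1, by omega⟩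
    have h3 : (1 + 3 ^ (d + 1) * w) ^ 3 =
        1 + 3 ^ (d + 1 + 1) * (w + 3 * (3 ^ d * w ^ 2 + 3 ^ (2 * d) * w ^ 3)) := by
      ring
    obtain ⟨z, hz⟩ := ih (d + 1 + 1) (by omega)
      (w + 3 * (3 ^ d * w ^ 2 + 3 ^ (2 * d) * w ^ 3)) m
    refine ⟨z + m * (3 ^ d * w ^ 2 + 3 ^ (2 * d) * w ^ 3), ?_⟩
    rw [show 3 ^ (k + 1) * m = 3 * (3 ^ k * m) by ring, pow_mul, h3, hz]
    ring

lemma three_mul_coords (e : ℕ) (w : CubS) :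
    ((3 : CubS) ^ e * w).p = 3 ^ e * w.p ∧ ((3 : CubS) ^ e * w).q = 3 ^ e * w.q ∧
      ((3 : CubS) ^ e * w).r = 3 ^ e * w.r := by
  have h : (3 : CubS) ^ e = cst (3 ^ e) := by rw [map_pow, map_ofNat]
  rw [h]
  simp only [mul_p, mul_q, mul_r, cst_p, cst_q, cst_r]
  refine ⟨?_, ?_, ?_⟩ <;> ring

lemma lin_coords (m : ℕ) (w z : CubS) :
    ((m : CubS) * w + 3 * z).q = m * w.q + 3 * z.q ∧
      ((m : CubS) * w + 3 * z).r = m * w.r + 3 * z.r := by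
  have h : (3 : CubS) = cst 3 := by rw [map_ofNat]
  have h' : (m : CubS) = cst m := by rw [map_natCast]
  rw [h, h']
  simp only [add_q, add_r, mul_q, mul_r, cst_p, cst_q, cst_r]
  refine ⟨?_, ?_⟩ <;> ring

/-- Powers of `1 + 3^e w`: leading behaviour of the `θ` and `φ` coordinates. -/
lemma pow_coords (e : ℕ) (he : 1 ≤ e) (w : CubS) (a : ℕ) (ha : 0 < a) :
    ∃ (f m : ℕ) (z : CubS), ¬ 3 ∣ m ∧
      ((1 + 3 ^ e * w) ^ a).q = 3 ^ f * (m * w.q + 3 * z.q) ∧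
      ((1 + 3 ^ e * w) ^ a).r = 3 ^ f * (m * w.r + 3 * z.r) := by
  obtain ⟨k, m, hm, rfl⟩ := Nat.exists_eq_pow_mul_and_not_dvd ha.ne' 3 (by norm_num)
  obtain ⟨z, hz⟩ := pow_one_add' k e he w m
  refine ⟨e + k, m, z, hm, ?_, ?_⟩
  · rw [hz, add_q, (three_mul_coords _ _).2.1, (lin_coords _ _ _).1, one_q, zero_add]
  · rw [hz, add_r, (three_mul_coords _ _).2.2, (lin_coords _ _ _).2, one_r, zero_add]

lemma contra (u v w1 w2 : CubS) (e1 e2 : ℕ) (he1 : 1 ≤ e1) (he2 : 1 ≤ e2)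
    (hu : u = 1 + 3 ^ e1 * w1) (hv : v = 1 + 3 ^ e2 * w2)
    (h1 : (3 : ℤ) ∣ w1.q - w1.r) (h1' : ¬ (3 : ℤ) ∣ w1.q)
    (h2 : (3 : ℤ) ∣ w2.q + w2.r) (h2' : ¬ (3 : ℤ) ∣ w2.q)
    (a c : ℕ) (ha : 0 < a) (h : u ^ a = v ^ c) : False := by
  have p3 : Prime (3 : ℤ) := Int.prime_three
  obtain ⟨f, m, z, hm, hq, hr⟩ := pow_coords e1 he1 w1 a ha
  rw [← hu, h] at hq hr
  have hm' : ¬ (3 : ℤ) ∣ m := by exact_mod_cast hm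
  rcases Nat.eq_zero_or_pos c with rfl | hc
  · rw [pow_zero, one_q] at hq
    have h0 : (m : ℤ) * w1.q + 3 * z.q = 0 := by
      rcases mul_eq_zero.1 hq.symm with h | h
      · exact absurd h (by positivity)
      · exact h
    have : (3 : ℤ) ∣ m * w1.q := ⟨-z.q, by linarith⟩
    rcases p3.dvd_or_dvd this with h | h
    · exact hm' h
    · exact h1' h
  · obtain ⟨g, n, y, hn, hq2, hr2⟩ := pow_coords e2 he2 w2 c hc
    rw [← hv] at hq2 hr2
    have hn' : ¬ (3 : ℤ) ∣ n := by exact_mod_cast hn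
    rw [hq] at hq2
    rw [hr] at hr2
    have hcross : ((m : ℤ) * w1.q + 3 * z.q) * (n * w2.r + 3 * y.r) =
        (m * w1.r + 3 * z.r) * (n * w2.q + 3 * y.q) := by
      have hpos : (3 : ℤ) ^ f * 3 ^ g ≠ 0 := by positivity
      apply mul_left_cancel₀ hpos
      linear_combination (3 ^ g * (n * w2.r + 3 * y.r)) * hq2
        - (3 ^ g * (n * w2.q + 3 * y.q)) * hr2
    obtain ⟨i, hi⟩ := h1
    obtain ⟨j, hj⟩ := h2
    have hi' : w1.r = w1.q - 3 * i := by linarith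
    have hj' : w2.r = 3 * j - w2.q := by linarith
    rw [hi', hj'] at hcross
    have hd : (3 : ℤ) ∣ 2 * (m * w1.q * (n * w2.q)) := by
      refine ⟨m * w1.q * (n * j + y.r) + z.q * (n * (3 * j - w2.q) + 3 * y.r)
        - (m * w1.q * y.q + (z.r - m * i) * (n * w2.q + 3 * y.q)), ?_⟩
      linear_combination -hcross
    rcases p3.dvd_or_dvd hd with h | h
    · norm_num at h
    · rcases p3.dvd_or_dvd h with h | h
      · rcases p3.dvd_or_dvd h with h | h
        · exact hm' h
        · exact h1' h
      · rcases p3.dvd_or_dvd h with h | h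
        · exact hn' h
        · exact h2' h

/-- The unit `(∛9 + ∛6 + ∛4)^3`. -/
def g : CubSˣ where
  val := ⟨55, 24, 21⟩
  inv := ⟨1, 3, -3⟩
  val_inv := by ext <;> simp
  inv_val := by ext <;> simp

/-- The norm-one element attached to a solution. -/
def unitOf (p D : ℤ) (h : N ⟨p, D, D⟩ = 1) : CubSˣ where
  val := ⟨p, D, D⟩
  inv := ⟨p ^ 2 - 6 * D * D, 3 * D ^ 2 - p * D, 2 * D ^ 2 - p * D⟩
  val_inv := by
    rw [N_def] at h
    ext <;> simp <;> linarith
  inv_val := by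
    rw [N_def] at h
    ext <;> simp <;> linarith

lemma solve (x y : ℤ) (h : 3 * x ^ 3 - 2 * y ^ 3 = 1) : x = y := by
  by_contra hne
  obtain ⟨D, hD⟩ : ∃ D, D = x - y := ⟨_, rfl⟩
  obtain ⟨p, hp⟩ : ∃ p, p = 3 * x - 2 * y := ⟨_, rfl⟩
  have hD0 : D ≠ 0 := by rw [hD]; exact sub_ne_zero.2 hne
  have hN : p ^ 3 + 30 * D ^ 3 - 18 * p * D ^ 2 = 1 := by
    rw [hD, hp]; linear_combination h
  have hN' : N ⟨p, D, D⟩ = 1 := by rw [N_def]; simp; linear_combination hN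
  have p3 : Prime (3 : ℤ) := Int.prime_three
  -- `p ≡ 1 mod 3`
  obtain ⟨j, hj⟩ : ∃ j, p = 1 + 3 * j := by
    have : p % 3 = 1 := by
      have h3 : (p ^ 3) % 3 = 1 := by
        have : p ^ 3 = 1 + 3 * (6 * p * D ^ 2 - 10 * D ^ 3) := by linarith
        omega
      have : p % 3 = 0 ∨ p % 3 = 1 ∨ p % 3 = 2 := by omega
      rcases this with h | h | h <;> simp [pow_succ, Int.mul_emod, h] at h3 ⊢
    exact ⟨p / 3, by omega⟩
  have hj3 : 9 * (j * (1 + 3 * (j + j ^ 2))) = 18 * p * D ^ 2 - 30 * D ^ 3 := by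
    rw [hj] at hN ⊢; linear_combination hN
  have hD3 : (3 : ℤ) ∣ D := by
    have : (3 : ℤ) ∣ D ^ 3 :=
      ⟨2 * p * D ^ 2 - 3 * D ^ 3 - j * (1 + 3 * (j + j ^ 2)), by linarith⟩ 
    exact p3.dvd_of_dvd_pow this
  obtain ⟨e, D', hD', he⟩ : ∃ (e : ℕ) (D' : ℤ), ¬ (3 : ℤ) ∣ D' ∧ D = 3 ^ e * D' := by
    have hf : FiniteMultiplicity (3 : ℤ) D := Int.finiteMultiplicity_iff.2 ⟨by norm_num, hD0⟩
    obtain ⟨c, hc, hc'⟩ := hf.exists_eq_pow_mul_and_not_dvd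
    exact ⟨_, c, hc', hc⟩
  have he1 : 1 ≤ e := by
    by_contra h0
    have : e = 0 := by omega
    rw [this, pow_zero, one_mul] at he
    exact hD' (he ▸ hD3)
  obtain ⟨d, rfl⟩ : ∃ d, e = d + 1 := ⟨e - 1, by omega⟩
  have hjd : (3 : ℤ) ^ (d + 1) ∣ j := by
    have h1 : (3 : ℤ) ^ (d + 1) ∣ j * (1 + 3 * (j + j ^ 2)) := by
      refine ⟨2 * p * 3 ^ (d + 1) * D' ^ 2 - 10 * (3 ^ d) * 3 ^ (d + 1) * D' ^ 3, ?_⟩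
      have : (9 : ℤ) ≠ 0 := by norm_num
      apply mul_left_cancel₀ this
      rw [hj3, he]
      ring
    refine IsCoprime.dvd_of_dvd_mul_right (IsCoprime.pow_left ?_) h1
    exact ⟨-(j + j ^ 2), 1, by ring⟩
  obtain ⟨i, hi⟩ := hjd
  have hu : ((unitOf p D hN' : CubSˣ) : CubS) = 1 + 3 ^ (d + 1) * ⟨3 * i, D', D'⟩ := by
    have hc := three_mul_coords (d + 1) ⟨3 * i, D', D'⟩
    ext
    · rw [add_p, hc.1]; simp [unitOf]; rw [hj, hi]; ring
    · rw [add_q, hc.2.1]; simp [unitOf]; rw [he]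
    · rw [add_r, hc.2.2]; simp [unitOf]; rw [he]
  obtain ⟨a, c, ha, hac⟩ := depend (unitOf p D hN') g hN' (by simp [N_def, g])
    (by simp [g]) (by simp [g]) (by simp [g])
  have hg1 : ((g : CubSˣ) : CubS) = 1 + 3 ^ 1 * ⟨18, 8, 7⟩ := by
    have hc := three_mul_coords 1 ⟨18, 8, 7⟩
    ext
    · rw [add_p, hc.1]; simp [g]
    · rw [add_q, hc.2.1]; simp [g]
    · rw [add_r, hc.2.2]; simp [g]
  have hg2 : ((g⁻¹ : CubSˣ) : CubS) = 1 + 3 ^ 1 * ⟨0, 1, -1⟩ := by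
    have hc := three_mul_coords 1 ⟨0, 1, -1⟩
    change (⟨1, 3, -3⟩ : CubS) = _
    ext
    · rw [add_p, hc.1]; simp
    · rw [add_q, hc.2.1]; simp
    · rw [add_r, hc.2.2]; simp
  obtain ⟨n, rfl | rfl⟩ := c.eq_nat_or_neg
  · refine contra _ _ _ _ _ _ he1 le_rfl hu hg1 (by simp) hD' (by norm_num) (by norm_num) a n ha ?_
    rw [zpow_natCast] at hac
    exact_mod_cast congrArg Units.val hac
  · refine contra _ _ _ _ _ _ he1 le_rfl hu hg2 (by simp) hD' (by norm_num) (by norm_num) a n ha ?_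
    rw [zpow_neg, zpow_natCast, ← inv_pow] at hac
    have := congrArg Units.val hac
    rwa [Units.val_pow_eq_pow_val, Units.val_pow_eq_pow_val] at this

end CubS

theorem thue_r1 : ¬ ∃ (x y : ℤ) (t : ℕ), 1 ≤ t ∧ y = 2 ^ t ∧ 3 * x ^ 3 - 2 * y ^ 3 = 1 := by
  rintro ⟨x, y, t, ht, hy, h⟩
  have hxy := CubS.solve x y h
  subst hxy
  have h1 : x ^ 3 = 1 := by linarith
  have h2 : (2 : ℤ) ∣ x := hy ▸ dvd_pow_self 2 (by omega)
  have h3 : (2 : ℤ) ∣ x ^ 3 := dvd_pow h2 (by norm_num)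
  rw [h1] at h3
  norm_num at h3
end

section
/- There is no integer solution (x, n) with n ≥ 3 to the equation 3*x^5 = 2^n + 1. -/
/-- The `61` reciprocity condition. -/
lemma fpc_symbol61 (x k : ℕ) (hx8 : x % 8 = 3) 
    (h : 3 * x ^ 5 = 64 * (2 * 4 ^ k) ^ 5 + 1) (L : ℕ) (hL : x = 2 * 4 ^ k + L)
    (hh : (2 * 4 ^ k) % 8 = 0) :
    jacobiSym (L : ℤ) 61 = 1 := by
  have hL8 : L % 8 = 3 := by omega
  have hxodd : Odd x := Nat.odd_iff.2 (by omega)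
  have hLodd : Odd L := Nat.odd_iff.2 (by omega)
  have hcop : Nat.Coprime x 2 := (Nat.coprime_two_right).2 hxodd
  -- -61 x^5 = 1 mod L
  have h1 : jacobiSym (-61 * (x : ℤ) ^ 5) L = 1 := by
    have hz : (3 : ℤ) * x ^ 5 = 64 * (2 * 4 ^ k) ^ 5 + 1 := by exact_mod_cast h
    have hLz : (x : ℤ) = 2 * 4 ^ k + L := by exact_mod_cast hL
    have hm : (-61 * (x : ℤ) ^ 5) % L = 1 % L := by
      apply Int.ModEq.symm
      rw [Int.modEq_iff_dvd]
      have h2 : -61 * (x : ℤ) ^ 5 - 1 = 64 * ((2 * 4 ^ k) ^ 5 - (x : ℤ) ^ 5) := by linarith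
      rw [h2]
      refine Dvd.dvd.mul_left ?_ _
      refine dvd_trans ?_ (sub_dvd_pow_sub_pow _ _ 5)
      exact ⟨-1, by rw [hLz]; ring⟩
    rw [jacobiSym.mod_left, hm, ← jacobiSym.mod_left, jacobiSym.one_left]
  have h2 : jacobiSym (L : ℤ) x = 1 := by
    have hm : (L : ℤ) % x = (-2 * (2 ^ k) ^ 2) % x := by
      apply Int.ModEq.symm
      rw [Int.modEq_iff_dvd]
      have hLz : (x : ℤ) = 2 * 4 ^ k + L := by exact_mod_cast hL
      refine ⟨1, ?_⟩
      rw [hLz, ← pow_mul, mul_comm k 2, pow_mul]; norm_num; ring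
    rw [jacobiSym.mod_left, hm, ← jacobiSym.mod_left, jacobiSym.mul_left, jacobiSym.sq_one',
      mul_one, jacobiSym.at_neg_two hxodd, ZMod.χ₈'_nat_eq_if_mod_eight]
    · simp [hx8]; omega
    · have : Nat.Coprime (2 ^ k) x := (Nat.Coprime.pow_right k hcop).symm
      rw [Int.gcd_comm]; simpa [Int.gcd, Int.natAbs_pow, Nat.coprime_comm] using this
  have h3 : jacobiSym (x : ℤ) L = -1 := by
    rw [jacobiSym.quadratic_reciprocity_three_mod_four (by omega) (by omega), h2]
  have h4 : jacobiSym (-1) L = -1 := by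
    rw [jacobiSym.at_neg_one hLodd, ZMod.χ₄_nat_three_mod_four (by omega)]
  have h5 : jacobiSym (61 : ℕ) L = jacobiSym (L : ℤ) 61 :=
    jacobiSym.quadratic_reciprocity_one_mod_four (by norm_num) hLodd
  have h6 : (-61 * (x : ℤ) ^ 5) = (-1) * ((61 : ℕ) : ℤ) * (x : ℤ) ^ 5 := by norm_num
  rw [h6, jacobiSym.mul_left, jacobiSym.mul_left, jacobiSym.pow_left, h3, h4, h5] at h1
  linarith

/-- The `67` reciprocity condition. -/
lemma fpc_symbol67 (x k : ℕ) (hx8 : x % 8 = 3)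
    (h : 3 * x ^ 5 = 64 * (2 * 4 ^ k) ^ 5 + 1) (L : ℕ) (hL : L = x + 2 * 4 ^ k)
    (hh : (2 * 4 ^ k) % 8 = 0) :
    jacobiSym (L : ℤ) 67 = -1 := by
  have hL8 : L % 8 = 3 := by omega
  have hxodd : Odd x := Nat.odd_iff.2 (by omega)
  have hcop : Nat.Coprime x 2 := (Nat.coprime_two_right).2 hxodd
  have hLz : (L : ℤ) = x + 2 * 4 ^ k := by exact_mod_cast hL
  have h1 : jacobiSym (67 * (x : ℤ) ^ 5) L = 1 := by
    have hz : (3 : ℤ) * x ^ 5 = 64 * (2 * 4 ^ k) ^ 5 + 1 := by exact_mod_cast h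
    have hm : (67 * (x : ℤ) ^ 5) % L = 1 % L := by
      apply Int.ModEq.symm
      rw [Int.modEq_iff_dvd]
      have h2 : 67 * (x : ℤ) ^ 5 - 1 = 64 * ((x : ℤ) ^ 5 - (-(2 * 4 ^ k)) ^ 5) := by
        rw [Odd.neg_pow (by decide)]; linarith
      rw [h2]
      refine Dvd.dvd.mul_left ?_ _
      refine dvd_trans ?_ (sub_dvd_pow_sub_pow _ _ 5)
      exact ⟨1, by rw [hLz]; ring⟩
    rw [jacobiSym.mod_left, hm, ← jacobiSym.mod_left, jacobiSym.one_left]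
  have h2 : jacobiSym (L : ℤ) x = -1 := by
    have hm : (L : ℤ) % x = (2 * (2 ^ k) ^ 2) % x := by
      apply Int.ModEq.symm
      rw [Int.modEq_iff_dvd]
      refine ⟨1, ?_⟩
      rw [hLz, ← pow_mul, mul_comm k 2, pow_mul]; norm_num
    rw [jacobiSym.mod_left, hm, ← jacobiSym.mod_left, jacobiSym.mul_left, jacobiSym.sq_one',
      mul_one, jacobiSym.at_two hxodd, ZMod.χ₈_nat_eq_if_mod_eight]
    · simp [hx8]; omega
    · have : Nat.Coprime (2 ^ k) x := (Nat.Coprime.pow_right k hcop).symm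
      rw [Int.gcd_comm]; simpa [Int.gcd, Int.natAbs_pow, Nat.coprime_comm] using this
  have h3 : jacobiSym (x : ℤ) L = 1 := by
    rw [jacobiSym.quadratic_reciprocity_three_mod_four (by omega) (by omega), h2]; norm_num
  have h5 : jacobiSym (67 : ℕ) L = -jacobiSym (L : ℤ) 67 :=
    jacobiSym.quadratic_reciprocity_three_mod_four (by norm_num) (by omega)
  have h6 : (67 * (x : ℤ) ^ 5) = ((67 : ℕ) : ℤ) * (x : ℤ) ^ 5 := by norm_num
  rw [h6, jacobiSym.mul_left, jacobiSym.pow_left, h3, h5] at h1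
  linarith

/-- Fermat-type local condition for fifth powers modulo a prime `p = 5 q + 1`. -/
lemma fpc_local (p q : ℕ) [Fact p.Prime] (hpq : p = 5 * q + 1) (x c : ZMod p)
    (h : 3 * x ^ 5 = c) : c = 0 ∨ c ^ q = 3 ^ q := by
  by_cases hx : x = 0
  · left; rw [← h, hx]; simp
  · right
    rw [← h, mul_pow, ← pow_mul]
    have := ZMod.pow_card_sub_one_eq_one hx
    rw [show p - 1 = 5 * q by omega] at this
    rw [this, mul_one]

lemma fpc_pow_mod {R : Type*} [Monoid R] (a : R) (d s : ℕ) (h : a ^ d = 1) :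
    a ^ s = a ^ (s % d) := by
  conv_lhs => rw [← Nat.div_add_mod s d, pow_add, pow_mul, h, one_pow, one_mul]

instance fpc_p31 : Fact (Nat.Prime 31) := ⟨by norm_num⟩
instance fpc_p61 : Fact (Nat.Prime 61) := ⟨by norm_num⟩
instance fpc_p67 : Fact (Nat.Prime 67) := ⟨by norm_num⟩
instance fpc_p661 : Fact (Nat.Prime 661) := ⟨by norm_num⟩
instance fpc_p881 : Fact (Nat.Prime 881) := ⟨by norm_num⟩

lemma fpc_dec31 : ∀ r < 5, ((2 : ZMod 31) ^ r + 1 = 0 ∨ ((2 : ZMod 31) ^ r + 1) ^ 6 = 3 ^ 6) →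
    r = 1 := by decide +kernel

lemma fpc_dec61 : ∀ r < 30, ∀ x : ZMod 61, 3 * x ^ 5 = 64 * (2 * 4 ^ r) ^ 5 + 1 →
    (x - 2 * 4 ^ r) ^ 30 = 1 → r % 6 = 5 := by decide +kernel

lemma fpc_dec67 : ∀ r < 33, ∀ x : ZMod 67, 3 * x ^ 5 = 64 * (2 * 4 ^ r) ^ 5 + 1 →
    (x + 2 * 4 ^ r) ^ 33 = -1 → r % 3 = 2 → [5, 0, 6, 9, 1, 4, 7].contains (r % 11) = true := by
  decide +kernel

lemma fpc_dec661 : ∀ r < 66, r % 6 = 5 → [5, 0, 6, 9, 1, 4, 7].contains (r % 11) = true →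
    (64 * 32 * (1024 : ZMod 661) ^ r + 1 = 0 ∨
      (64 * 32 * (1024 : ZMod 661) ^ r + 1) ^ 132 = 3 ^ 132) → r = 11 ∨ r = 17 := by
  decide +kernel

lemma fpc_dec881 : ∀ r < 66, r = 11 ∨ r = 17 →
    ¬ (64 * 32 * (1024 : ZMod 881) ^ r + 1 = 0 ∨
      (64 * 32 * (1024 : ZMod 881) ^ r + 1) ^ 176 = 3 ^ 176) := by
  decide +kernel

lemma fpc_main (x k : ℕ) (hk : 1 ≤ k) (h : 3 * x ^ 5 = 64 * (2 * 4 ^ k) ^ 5 + 1) : False := by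
  have hh : (2 * 4 ^ k) % 8 = 0 := by
    obtain ⟨j, rfl⟩ := Nat.exists_eq_add_of_le hk
    rw [pow_add]; omega
  have hx8 : x % 8 = 3 := by
    have h1 : (3 * x ^ 5) % 8 = 1 := by rw [h]; omega
    have h2 : (3 * (x % 8) ^ 5) % 8 = 1 := by
      rw [← h1]; simp [Nat.mul_mod, Nat.pow_mod]
    have h3 : ∀ r < 8, (3 * r ^ 5) % 8 = 1 → r = 3 := by decide
    exact h3 _ (Nat.mod_lt _ (by norm_num)) h2
  have hle : 2 * 4 ^ k ≤ x := by
    by_contra hlt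
    push Not at hlt
    have := Nat.pow_le_pow_left hlt.le 5
    omega
  obtain ⟨L, hL⟩ := Nat.exists_eq_add_of_le hle
  have s61 := fpc_symbol61 x k hx8 h L hL hh
  have s67 := fpc_symbol67 x k hx8 h _ rfl hh
  have e61 : ((x : ZMod 61) - 2 * 4 ^ k) ^ 30 = 1 := by
    have h1 := legendreSym.eq_pow 61 (L : ℤ)
    rw [jacobiSym.legendreSym.to_jacobiSym, s61] at h1
    have hc : ((L : ℤ) : ZMod 61) = (x : ZMod 61) - 2 * 4 ^ k := by rw [hL]; push_cast; ring
    rw [hc] at h1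
    simpa using h1.symm
  have e67 : ((x : ZMod 67) + 2 * 4 ^ k) ^ 33 = -1 := by
    have h1 := legendreSym.eq_pow 67 ((x + 2 * 4 ^ k : ℕ) : ℤ)
    rw [jacobiSym.legendreSym.to_jacobiSym, s67] at h1
    push_cast at h1
    simpa using h1.symm
  have c61 : 3 * (x : ZMod 61) ^ 5 = 64 * (2 * 4 ^ k) ^ 5 + 1 := by exact_mod_cast congrArg (Nat.cast) h
  have c67 : 3 * (x : ZMod 67) ^ 5 = 64 * (2 * 4 ^ k) ^ 5 + 1 := by exact_mod_cast congrArg (Nat.cast) h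
  have h' : 3 * x ^ 5 = 64 * 32 * 1024 ^ k + 1 := by
    rw [h, mul_pow, ← pow_mul, mul_comm k 5, pow_mul]; norm_num; ring
  have c661 : 3 * (x : ZMod 661) ^ 5 = 64 * 32 * 1024 ^ k + 1 := by
    exact_mod_cast congrArg (Nat.cast) h'
  have c881 : 3 * (x : ZMod 881) ^ 5 = 64 * 32 * 1024 ^ k + 1 := by
    exact_mod_cast congrArg (Nat.cast) h'
  rw [fpc_pow_mod (4 : ZMod 61) 30 k (by decide +kernel)] at c61 e61
  rw [fpc_pow_mod (4 : ZMod 67) 33 k (by decide +kernel)] at c67 e67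
  rw [fpc_pow_mod (1024 : ZMod 661) 66 k (by decide +kernel)] at c661
  rw [fpc_pow_mod (1024 : ZMod 881) 66 k (by decide +kernel)] at c881
  have r61 := fpc_dec61 (k % 30) (Nat.mod_lt _ (by norm_num)) _ c61 e61
  have r67 := fpc_dec67 (k % 33) (Nat.mod_lt _ (by norm_num)) _ c67 e67 (by omega)
  have m1 : k % 66 % 6 = 5 := by omega
  have m2 : k % 66 % 11 = k % 33 % 11 := by omega
  rw [← m2] at r67
  have r661 := fpc_dec661 (k % 66) (Nat.mod_lt _ (by norm_num)) m1 r67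
    (fpc_local 661 132 (by norm_num) _ _ c661)
  exact fpc_dec881 (k % 66) (Nat.mod_lt _ (by norm_num)) r661
    (fpc_local 881 176 (by norm_num) _ _ c881)

theorem fifth_power_case : ¬ ∃ (x : ℤ) (n : ℕ), 3 ≤ n ∧ 3 * x ^ 5 = 2 ^ n + 1 := by
  rintro ⟨x, n, hn, h⟩
  have hx0 : 0 ≤ x := by
    by_contra hneg
    push Not at hneg
    have h1 : x ^ 5 < 0 := Odd.pow_neg (by decide) hneg
    have h2 : (0 : ℤ) < 2 ^ n := by positivity
    linarith
  lift x to ℕ using hx0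
  have hN : 3 * x ^ 5 = 2 ^ n + 1 := by exact_mod_cast h
  -- n is odd
  have hodd : n % 2 = 1 := by
    have c3 : 3 * (x : ZMod 3) ^ 5 = 2 ^ n + 1 := by exact_mod_cast congrArg (Nat.cast) hN
    rw [fpc_pow_mod (2 : ZMod 3) 2 n (by decide), show (3 : ZMod 3) = 0 by decide, zero_mul] at c3
    rcases Nat.mod_two_eq_zero_or_one n with h0 | h0
    · rw [h0] at c3; exact absurd c3 (by decide)
    · exact h0
  have h5 : n % 5 = 1 := by
    have c31 : 3 * (x : ZMod 31) ^ 5 = 2 ^ n + 1 := by exact_mod_cast congrArg (Nat.cast) hN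
    rw [fpc_pow_mod (2 : ZMod 31) 5 n (by decide)] at c31
    exact fpc_dec31 _ (Nat.mod_lt _ (by norm_num)) (fpc_local 31 6 (by norm_num) _ _ c31)
  obtain ⟨k, hk⟩ : ∃ k, n = 10 * k + 11 := ⟨(n - 11) / 10, by omega⟩
  have hN' : 3 * x ^ 5 = 64 * (2 * 4 ^ k) ^ 5 + 1 := by
    rw [hN, hk, pow_add, pow_mul, mul_pow, ← pow_mul 4 k 5, mul_comm k 5, pow_mul]; norm_num; ring
  rcases Nat.eq_zero_or_pos k with rfl | hpos
  · have hlt : x < 4 := by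
      by_contra hge
      push Not at hge
      have := Nat.pow_le_pow_left hge 5
      omega
    interval_cases x <;> omega
  · exact fpc_main x k hpos hN'
end
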